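/- Let n ≥ 1, let Ω ⊂ ℝⁿ be open and bounded, and let E ⊂ ℝⁿ be measurable with Per_{s₀}(E,Ω) < ∞ for some s₀ ∈ (0,1/2). Assume there exist c* > 0 and η > 2s₀ such that 𝓛ⁿ(D_r^Ω(Ω^c)) ≤ c* · min{r^η, 1} for all r ∈ [0,1]. If 𝓛ⁿ(E ∩ Ω) = 𝓛ⁿ(E^c ∩ Ω), then lim_{s→0⁺} s · Per_s(E,Ω) exists and equals 2 𝓛ⁿ(E ∩ Ω). -/

import Mathlib

open MeasureTheory Real Filter Topology Set
open scoped ENNReal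

/-- The classical heat kernel on `ℝⁿ`. -/
noncomputable def heatKernel (n : ℕ) (t : ℝ) (x y : EuclideanSpace ℝ (Fin n)) : ℝ :=
  (4 * π * t) ^ (-(n : ℝ) / 2) * Real.exp (-‖x - y‖ ^ 2 / (4 * t))

/-- `L_s(A,B) = ∫₀^∞ t^{-(1+s)} ∫_A ∫_B p_t(x,y) dy dx dt`. -/
noncomputable def Lfun (n : ℕ) (s : ℝ) (A B : Set (EuclideanSpace ℝ (Fin n))) : ℝ≥0∞ :=
  ∫⁻ t in Set.Ioi (0:ℝ), ENNReal.ofReal (t ^ (-(1 + s))) *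
    ∫⁻ x in A, ∫⁻ y in B, ENNReal.ofReal (heatKernel n t x y)

/-- The relative `s`-perimeter
`Per_s(E,Ω) = 2[L_s(E∩Ω, Eᶜ∩Ω) + L_s(E∩Ω, Eᶜ∩Ωᶜ) + L_s(E∩Ωᶜ, Eᶜ∩Ω)]`. -/
noncomputable def sPer (n : ℕ) (s : ℝ) (E Ω : Set (EuclideanSpace ℝ (Fin n))) : ℝ≥0∞ :=
  2 * (Lfun n s (E ∩ Ω) (Eᶜ ∩ Ω) + Lfun n s (E ∩ Ω) (Eᶜ ∩ Ωᶜ) + Lfun n s (E ∩ Ωᶜ) (Eᶜ ∩ Ω))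

/-- The inner collar `D_r^Ω(Ωᶜ) = {x ∈ Ω : dist(x, Ωᶜ) ≤ r}`. -/
def innerCollar (n : ℕ) (Ω : Set (EuclideanSpace ℝ (Fin n))) (r : ℝ) :
    Set (EuclideanSpace ℝ (Fin n)) :=
  {x | x ∈ Ω ∧ Metric.infDist x Ωᶜ ≤ r}

lemma heatKernel_nonneg {n : ℕ} {t : ℝ} (ht : 0 < t) (x y : EuclideanSpace ℝ (Fin n)) :
    0 ≤ heatKernel n t x y := by
  unfold heatKernel; positivity

lemma heatKernel_comm (n : ℕ) (t : ℝ) (x y : EuclideanSpace ℝ (Fin n)) :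
    heatKernel n t x y = heatKernel n t y x := by
  unfold heatKernel; rw [norm_sub_rev]

lemma measurable_heatKernel (n : ℕ) :
    Measurable fun q : ℝ × EuclideanSpace ℝ (Fin n) × EuclideanSpace ℝ (Fin n) =>
      heatKernel n q.1 q.2.1 q.2.2 := by
  unfold heatKernel; fun_prop

/-- The heat kernel has total mass one. -/
lemma lintegral_heatKernel {n : ℕ} {t : ℝ} (ht : 0 < t) (x : EuclideanSpace ℝ (Fin n)) :
    ∫⁻ y, ENNReal.ofReal (heatKernel n t x y) = 1 := by
  have h4 : 0 < 4 * π * t := by positivity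
  have key : ∫ y, heatKernel n t x y = 1 := by
    have h1 : ∀ y, heatKernel n t x y =
        (fun z => (4 * π * t) ^ (-(n : ℝ) / 2) * Real.exp (-(1 / (4 * t)) * ‖z‖ ^ 2)) (x - y) := by
      intro y
      simp only [heatKernel]
      congr 2
      ring
    simp_rw [h1]
    rw [integral_sub_left_eq_self
      (fun z : EuclideanSpace ℝ (Fin n) =>
        (4 * π * t) ^ (-(n : ℝ) / 2) * Real.exp (-(1 / (4 * t)) * ‖z‖ ^ 2)) volume x,
      integral_const_mul, GaussianFourier.integral_rexp_neg_mul_sq_norm (by positivity)]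
    rw [show π / (1 / (4 * t)) = 4 * π * t by field_simp, finrank_euclideanSpace_fin,
      ← Real.rpow_add h4]
    rw [show -(n : ℝ) / 2 + (n : ℝ) / 2 = 0 by ring, Real.rpow_zero]
  rw [← ofReal_integral_eq_lintegral_ofReal (.of_integral_ne_zero (by simp [key]))
    (.of_forall fun y => heatKernel_nonneg ht x y), key, ENNReal.ofReal_one]

lemma le_exp_half_sq (v : ℝ) : v ≤ Real.exp (v ^ 2 / 2) := by
  nlinarith [Real.add_one_le_exp (v ^ 2 / 2), sq_nonneg (v - 1)]

/-- Comparison of the heat kernel at two base points. -/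
lemma heatKernel_le_add {n : ℕ} {t D : ℝ} (ht : 0 < t) {x x' : EuclideanSpace ℝ (Fin n)}
    (hD : ‖x - x'‖ ≤ D) (y : EuclideanSpace ℝ (Fin n)) :
    heatKernel n t x y ≤ heatKernel n t x' y + D ^ 2 / (4 * t) * heatKernel n t x y
      + D / √t * 2 ^ ((n : ℝ) / 2) * heatKernel n (2 * t) x y := by
  have hD0 : 0 ≤ D := (norm_nonneg _).trans hD
  have hst : 0 < √t := Real.sqrt_pos.2 ht
  have hsq : √t ^ 2 = t := Real.sq_sqrt ht.le
  have hdouble : heatKernel n (2 * t) x y * 2 ^ ((n : ℝ) / 2) =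
      (4 * π * t) ^ (-(n : ℝ) / 2) * Real.exp (-‖x - y‖ ^ 2 / (8 * t)) := by
    unfold heatKernel
    rw [show 4 * π * (2 * t) = (4 * π * t) * 2 by ring,
      Real.mul_rpow (by positivity) (by norm_num), show 4 * (2 * t) = 8 * t by ring]
    have : (2 : ℝ) ^ (-(n : ℝ) / 2) * 2 ^ ((n : ℝ) / 2) = 1 := by
      rw [← Real.rpow_add two_pos, neg_div, neg_add_cancel, Real.rpow_zero]
    linear_combination (4 * π * t) ^ (-(n : ℝ) / 2) * Real.exp (-‖x - y‖ ^ 2 / (8 * t)) * this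
  have hmain : Real.exp (-‖x - y‖ ^ 2 / (4 * t)) ≤ Real.exp (-‖x' - y‖ ^ 2 / (4 * t))
      + D ^ 2 / (4 * t) * Real.exp (-‖x - y‖ ^ 2 / (4 * t))
      + D / √t * Real.exp (-‖x - y‖ ^ 2 / (8 * t)) := by
    set u := ‖x - y‖
    set w := ‖x' - y‖
    have hu : 0 ≤ u := norm_nonneg _
    have hw : w ≤ u + D := by
      have := norm_sub_le_norm_sub_add_norm_sub x' x y
      rw [norm_sub_rev x' x] at this
      linarith
    have hw0 : 0 ≤ w := norm_nonneg _
    have e1 : Real.exp (-w ^ 2 / (4 * t)) =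
        Real.exp (-u ^ 2 / (4 * t)) * Real.exp ((u ^ 2 - w ^ 2) / (4 * t)) := by
      rw [← Real.exp_add]; congr 1; ring
    have e2 : Real.exp (-u ^ 2 / (8 * t)) =
        Real.exp (-u ^ 2 / (4 * t)) * Real.exp ((u / (2 * √t)) ^ 2 / 2) := by
      rw [← Real.exp_add]; congr 1
      rw [div_pow, mul_pow, hsq]; field_simp; ring
    have i1 := Real.add_one_le_exp ((u ^ 2 - w ^ 2) / (4 * t))
    have i2 := le_exp_half_sq (u / (2 * √t))
    have i3 : -(D ^ 2 / (4 * t)) - D / √t * (u / (2 * √t)) ≤ (u ^ 2 - w ^ 2) / (4 * t) := by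
      rw [show D / √t * (u / (2 * √t)) = 2 * D * u / (4 * t) by
        rw [div_mul_div_comm, show √t * (2 * √t) = 2 * √t ^ 2 by ring, hsq]; field_simp; ring]
      rw [neg_sub_left, ← add_div, ← neg_div]
      gcongr
      nlinarith
    have i4 := mul_le_mul_of_nonneg_left i2 (by positivity : 0 ≤ D / √t)
    rw [e1, e2]
    have := mul_le_mul_of_nonneg_left
      (show (1 : ℝ) ≤ Real.exp ((u ^ 2 - w ^ 2) / (4 * t)) + D ^ 2 / (4 * t)
        + D / √t * Real.exp ((u / (2 * √t)) ^ 2 / 2) by linarith)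
      (Real.exp_pos (-u ^ 2 / (4 * t))).le
    linarith
  have := mul_le_mul_of_nonneg_left hmain
    (by positivity : 0 ≤ (4 * π * t) ^ (-(n : ℝ) / 2))
  rw [mul_assoc (D / √t), mul_comm (2 ^ ((n : ℝ) / 2) : ℝ), hdouble]
  unfold heatKernel
  linarith

/-- The heat content `∫_A ∫_B p_t(x,y) dy dx`. -/
noncomputable def heatContent (n : ℕ) (A B : Set (EuclideanSpace ℝ (Fin n))) (t : ℝ) : ℝ≥0∞ :=
  ∫⁻ x in A, ∫⁻ y in B, ENNReal.ofReal (heatKernel n t x y)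

section

variable {n : ℕ}

lemma measurable_heatContent (A B : Set (EuclideanSpace ℝ (Fin n))) :
    Measurable (heatContent n A B) := by
  have h : Measurable fun q : (ℝ × EuclideanSpace ℝ (Fin n)) × EuclideanSpace ℝ (Fin n) =>
      ENNReal.ofReal (heatKernel n q.1.1 q.1.2 q.2) :=
    ((measurable_heatKernel n).comp (by fun_prop :
      Measurable fun q : (ℝ × EuclideanSpace ℝ (Fin n)) × EuclideanSpace ℝ (Fin n) =>
        (q.1.1, q.1.2, q.2))).ennreal_ofReal
  exact (h.lintegral_prod_right' (ν := volume.restrict B)).lintegral_prod_right'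
    (ν := volume.restrict A)

lemma measurable_heatKernel_pair (t : ℝ) :
    Measurable fun q : EuclideanSpace ℝ (Fin n) × EuclideanSpace ℝ (Fin n) =>
      ENNReal.ofReal (heatKernel n t q.1 q.2) := by
  unfold heatKernel; fun_prop

lemma measurable_setLIntegral_heatKernel (t : ℝ) (B : Set (EuclideanSpace ℝ (Fin n))) :
    Measurable fun x => ∫⁻ y in B, ENNReal.ofReal (heatKernel n t x y) :=
  (measurable_heatKernel_pair t).lintegral_prod_right' (ν := volume.restrict B)

lemma measurable_heatKernel_right (t : ℝ) (x : EuclideanSpace ℝ (Fin n)) :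
    Measurable fun y => ENNReal.ofReal (heatKernel n t x y) := by
  unfold heatKernel; fun_prop

lemma heatContent_comm (A B : Set (EuclideanSpace ℝ (Fin n))) (t : ℝ) :
    heatContent n A B t = heatContent n B A t := by
  unfold heatContent
  rw [lintegral_lintegral_swap (measurable_heatKernel_pair t).aemeasurable]
  simp_rw [heatKernel_comm n t]

lemma heatContent_union {B B' : Set (EuclideanSpace ℝ (Fin n))} (hB' : MeasurableSet B')
    (hd : Disjoint B B') (A : Set (EuclideanSpace ℝ (Fin n))) (t : ℝ) :
    heatContent n A (B ∪ B') t = heatContent n A B t + heatContent n A B' t := by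
  unfold heatContent
  rw [← lintegral_add_left (measurable_setLIntegral_heatKernel t B)]
  simp_rw [lintegral_union hB' hd]

lemma heatContent_mono_right {B B' : Set (EuclideanSpace ℝ (Fin n))} (h : B ⊆ B')
    (A : Set (EuclideanSpace ℝ (Fin n))) (t : ℝ) :
    heatContent n A B t ≤ heatContent n A B' t :=
  lintegral_mono fun _ => lintegral_mono_set h

lemma heatContent_univ (A : Set (EuclideanSpace ℝ (Fin n))) {t : ℝ} (ht : 0 < t) :
    heatContent n A univ t = volume A := by
  simp [heatContent, lintegral_heatKernel ht]

lemma heatContent_le {t : ℝ} (ht : 0 < t) (A B : Set (EuclideanSpace ℝ (Fin n))) :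
    heatContent n A B t ≤
      ENNReal.ofReal ((4 * π * t) ^ (-(n : ℝ) / 2)) * volume B * volume A := by
  have h : ∀ x y, ENNReal.ofReal (heatKernel n t x y) ≤
      ENNReal.ofReal ((4 * π * t) ^ (-(n : ℝ) / 2)) := by
    intro x y
    apply ENNReal.ofReal_le_ofReal
    apply mul_le_of_le_one_right (by positivity)
    rw [Real.exp_le_one_iff, neg_div, neg_nonpos]
    positivity
  calc heatContent n A B t
      ≤ ∫⁻ _ in A, ∫⁻ _ in B, ENNReal.ofReal ((4 * π * t) ^ (-(n : ℝ) / 2)) :=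
        lintegral_mono fun x => lintegral_mono fun y => h x y
    _ = _ := by simp

lemma tendsto_heatContent_zero (hn : 1 ≤ n) {A B : Set (EuclideanSpace ℝ (Fin n))}
    (hA : volume A ≠ ⊤) (hB : volume B ≠ ⊤) :
    Tendsto (heatContent n A B) atTop (𝓝 0) := by
  have h1 : Tendsto (fun t : ℝ => (4 * π * t) ^ (-(n : ℝ) / 2)) atTop (𝓝 0) := by
    simp_rw [neg_div]
    have hn' : (0 : ℝ) < (n : ℝ) / 2 := by
      have : (0 : ℝ) < n := by exact_mod_cast hn
      positivity
    exact (tendsto_rpow_neg_atTop hn').comp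
      (tendsto_id.const_mul_atTop (by positivity : (0 : ℝ) < 4 * π))
  have h2 : Tendsto (fun t : ℝ =>
      ENNReal.ofReal ((4 * π * t) ^ (-(n : ℝ) / 2)) * volume B * volume A) atTop (𝓝 0) := by
    have h3 := ENNReal.tendsto_ofReal h1
    have h4 := ENNReal.Tendsto.mul_const (ENNReal.Tendsto.mul_const h3 (Or.inr hB)) (Or.inr hA)
    simpa using h4
  refine tendsto_of_tendsto_of_tendsto_of_le_of_le' tendsto_const_nhds h2
    (.of_forall fun _ => zero_le) ?_
  filter_upwards [eventually_gt_atTop 0] with t ht using heatContent_le ht A B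

/-- The modulus of continuity of the heat semigroup applied to an indicator, over distances
at most `D`. -/
noncomputable def heatModulus (n : ℕ) (D t : ℝ) : ℝ≥0∞ :=
  ENNReal.ofReal (D ^ 2 / (4 * t)) + ENNReal.ofReal (D / √t * 2 ^ ((n : ℝ) / 2))

lemma tendsto_heatModulus (n : ℕ) (D : ℝ) : Tendsto (heatModulus n D) atTop (𝓝 0) := by
  have h1 : Tendsto (fun t : ℝ => D ^ 2 / (4 * t)) atTop (𝓝 0) :=
    tendsto_const_nhds.div_atTop (tendsto_id.const_mul_atTop (by norm_num))
  have h2 : Tendsto (fun t : ℝ => D / √t * 2 ^ ((n : ℝ) / 2)) atTop (𝓝 0) := by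
    simpa using (tendsto_const_nhds.div_atTop tendsto_sqrt_atTop).mul_const _
  unfold heatModulus
  simpa using (ENNReal.tendsto_ofReal h1).add (ENNReal.tendsto_ofReal h2)

lemma setLIntegral_heatKernel_le_add {t D : ℝ} (ht : 0 < t) {x x' : EuclideanSpace ℝ (Fin n)}
    (hD : ‖x - x'‖ ≤ D) (B : Set (EuclideanSpace ℝ (Fin n))) :
    ∫⁻ y in B, ENNReal.ofReal (heatKernel n t x y) ≤
      (∫⁻ y in B, ENNReal.ofReal (heatKernel n t x' y)) + heatModulus n D t := by
  have hD0 : 0 ≤ D := (norm_nonneg _).trans hD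
  have hle : ∀ {τ : ℝ}, 0 < τ → ∫⁻ y in B, ENNReal.ofReal (heatKernel n τ x y) ≤ 1 := fun hτ =>
    (setLIntegral_le_lintegral _ _).trans (lintegral_heatKernel hτ x).le
  calc ∫⁻ y in B, ENNReal.ofReal (heatKernel n t x y)
      ≤ ∫⁻ y in B, (ENNReal.ofReal (heatKernel n t x' y)
          + ENNReal.ofReal (D ^ 2 / (4 * t)) * ENNReal.ofReal (heatKernel n t x y)
          + ENNReal.ofReal (D / √t * 2 ^ ((n : ℝ) / 2)) *
            ENNReal.ofReal (heatKernel n (2 * t) x y)) := by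
        refine lintegral_mono fun y => ?_
        have h0 := heatKernel_nonneg ht x y
        have h1 := heatKernel_nonneg ht x' y
        have h2 := heatKernel_nonneg (by positivity : 0 < 2 * t) x y
        rw [← ENNReal.ofReal_mul (by positivity), ← ENNReal.ofReal_mul (by positivity),
          ← ENNReal.ofReal_add h1 (by positivity), ← ENNReal.ofReal_add (by positivity)
          (by positivity)]
        exact ENNReal.ofReal_le_ofReal (heatKernel_le_add ht hD y)
    _ = (∫⁻ y in B, ENNReal.ofReal (heatKernel n t x' y))
          + ENNReal.ofReal (D ^ 2 / (4 * t)) * (∫⁻ y in B, ENNReal.ofReal (heatKernel n t x y))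
          + ENNReal.ofReal (D / √t * 2 ^ ((n : ℝ) / 2)) *
            ∫⁻ y in B, ENNReal.ofReal (heatKernel n (2 * t) x y) := by
        have m0 := measurable_heatKernel_right t x
        have m1 := measurable_heatKernel_right t x'
        have m2 := measurable_heatKernel_right (2 * t) x
        rw [lintegral_add_right _ (m2.const_mul _), lintegral_add_left m1,
          lintegral_const_mul _ m0, lintegral_const_mul _ m2]
    _ ≤ _ := by
        rw [heatModulus, add_assoc]
        gcongr
        · exact mul_le_of_le_one_right zero_le (hle ht)
        · exact mul_le_of_le_one_right zero_le (hle (by positivity))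

/-- Bounded sets of equal volume have asymptotically equal heat contents. -/
lemma heatContent_le_add_of_volume_eq {t R : ℝ} (ht : 0 < t)
    {A A' : Set (EuclideanSpace ℝ (Fin n))} (hA : MeasurableSet A) (hA' : MeasurableSet A')
    (hAR : ∀ x ∈ A, ‖x‖ ≤ R) (hAR' : ∀ x ∈ A', ‖x‖ ≤ R) (hvol : volume A = volume A')
    (B : Set (EuclideanSpace ℝ (Fin n))) :
    heatContent n A B t ≤ heatContent n A' B t + 2 * volume A * heatModulus n R t := by
  set h₀ := ∫⁻ y in B, ENNReal.ofReal (heatKernel n t 0 y) with hh₀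
  have h1 : heatContent n A B t ≤ (h₀ + heatModulus n R t) * volume A := by
    rw [← setLIntegral_const]
    exact setLIntegral_mono' hA fun x hx =>
      setLIntegral_heatKernel_le_add ht (by simpa using hAR x hx) B
  have h2 : h₀ * volume A' ≤ heatContent n A' B t + heatModulus n R t * volume A' := by
    rw [← setLIntegral_const, ← setLIntegral_const, heatContent,
      ← lintegral_add_left (measurable_setLIntegral_heatKernel t B)]
    exact setLIntegral_mono' hA' fun x hx =>
      setLIntegral_heatKernel_le_add ht (by simpa using hAR' x hx) B
  calc heatContent n A B t ≤ h₀ * volume A' + heatModulus n R t * volume A := by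
        rw [← hvol, ← add_mul]; exact h1
    _ ≤ heatContent n A' B t + heatModulus n R t * volume A' + heatModulus n R t * volume A := by
        gcongr
    _ = _ := by rw [← hvol]; ring

/-- The heat contents entering the relative perimeter converge to `𝓛ⁿ(E ∩ Ω)` for large times. -/
lemma tendsto_heatContent_perimeter (hn : 1 ≤ n) {E Ω : Set (EuclideanSpace ℝ (Fin n))}
    (hΩ : MeasurableSet Ω) (hΩb : Bornology.IsBounded Ω) (hE : MeasurableSet E)
    (hbal : volume (E ∩ Ω) = volume (Eᶜ ∩ Ω)) :
    Tendsto (fun t => heatContent n (E ∩ Ω) (Eᶜ ∩ Ω) t + heatContent n (E ∩ Ω) (Eᶜ ∩ Ωᶜ) t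
      + heatContent n (E ∩ Ωᶜ) (Eᶜ ∩ Ω) t) atTop (𝓝 (volume (E ∩ Ω))) := by
  obtain ⟨R, hR⟩ := hΩb.exists_norm_le
  have hvΩ : volume Ω ≠ ⊤ := hΩb.measure_lt_top.ne
  have hvA : volume (E ∩ Ω) ≠ ⊤ := measure_ne_top_of_subset inter_subset_right hvΩ
  set δ : ℝ → ℝ≥0∞ := fun t =>
    heatContent n (E ∩ Ω) Ω t + 2 * volume (E ∩ Ω) * heatModulus n R t
  have hδ : Tendsto δ atTop (𝓝 0) := by
    have h1 := ENNReal.Tendsto.const_mul (a := 2 * volume (E ∩ Ω)) (tendsto_heatModulus n R)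
      (Or.inr (ENNReal.mul_ne_top (by simp) hvA))
    simpa [δ] using (tendsto_heatContent_zero hn hvA hvΩ).add h1
  have hsplit : ∀ t, 0 < t → volume (E ∩ Ω) = heatContent n (E ∩ Ω) Ω t
      + (heatContent n (E ∩ Ω) (Eᶜ ∩ Ωᶜ) t + heatContent n (E ∩ Ω) (E ∩ Ωᶜ) t) := by
    intro t ht
    rw [← heatContent_union (hE.inter hΩ.compl), ← union_inter_distrib_right, compl_union_self,
      univ_inter, ← heatContent_union hΩ.compl disjoint_compl_right, union_compl_self,
      heatContent_univ _ ht]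
    exact disjoint_compl_left.mono inter_subset_left inter_subset_left
  have hlo : Tendsto (fun t => volume (E ∩ Ω) - δ t) atTop (𝓝 (volume (E ∩ Ω))) := by
    simpa using ENNReal.Tendsto.sub tendsto_const_nhds hδ (Or.inl hvA)
  have hhi : Tendsto (fun t => volume (E ∩ Ω) + δ t) atTop (𝓝 (volume (E ∩ Ω))) := by
    simpa using tendsto_const_nhds.add hδ
  have hAR : ∀ x ∈ E ∩ Ω, ‖x‖ ≤ R := fun x hx => hR x hx.2
  have hAR' : ∀ x ∈ Eᶜ ∩ Ω, ‖x‖ ≤ R := fun x hx => hR x hx.2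
  refine tendsto_of_tendsto_of_tendsto_of_le_of_le' hlo hhi ?_ ?_
  · filter_upwards [eventually_gt_atTop 0] with t ht
    rw [tsub_le_iff_right, heatContent_comm (E ∩ Ωᶜ)]
    have := heatContent_le_add_of_volume_eq ht (hE.inter hΩ) (hE.compl.inter hΩ) hAR hAR' hbal
      (E ∩ Ωᶜ)
    calc volume (E ∩ Ω) ≤ heatContent n (E ∩ Ω) Ω t + (heatContent n (E ∩ Ω) (Eᶜ ∩ Ωᶜ) t
          + (heatContent n (Eᶜ ∩ Ω) (E ∩ Ωᶜ) t + 2 * volume (E ∩ Ω) * heatModulus n R t)) := by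
          conv_lhs => rw [hsplit t ht]
          gcongr
      _ = 0 + heatContent n (E ∩ Ω) (Eᶜ ∩ Ωᶜ) t + heatContent n (Eᶜ ∩ Ω) (E ∩ Ωᶜ) t + δ t := by
          simp only [δ]; ring
      _ ≤ _ := by gcongr; exact zero_le
  · filter_upwards [eventually_gt_atTop 0] with t ht
    rw [heatContent_comm (E ∩ Ωᶜ)]
    have := heatContent_le_add_of_volume_eq ht (hE.compl.inter hΩ) (hE.inter hΩ) hAR' hAR
      hbal.symm (E ∩ Ωᶜ)
    rw [← hbal] at this
    have hm := heatContent_mono_right (inter_subset_right : Eᶜ ∩ Ω ⊆ Ω) (E ∩ Ω) t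
    calc heatContent n (E ∩ Ω) (Eᶜ ∩ Ω) t + heatContent n (E ∩ Ω) (Eᶜ ∩ Ωᶜ) t
          + heatContent n (Eᶜ ∩ Ω) (E ∩ Ωᶜ) t
        ≤ heatContent n (E ∩ Ω) Ω t + heatContent n (E ∩ Ω) (Eᶜ ∩ Ωᶜ) t
          + (heatContent n (E ∩ Ω) (E ∩ Ωᶜ) t + 2 * volume (E ∩ Ω) * heatModulus n R t) := by
          gcongr
      _ = 0 + (heatContent n (E ∩ Ω) (Eᶜ ∩ Ωᶜ) t + heatContent n (E ∩ Ω) (E ∩ Ωᶜ) t) + δ t := by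
          simp only [δ]; ring
      _ ≤ volume (E ∩ Ω) + δ t := by
          conv_rhs => rw [hsplit t ht]
          gcongr
          exact zero_le

end

lemma lintegral_Ioi_rpow_neg {s T : ℝ} (hs : 0 < s) (hT : 0 < T) :
    ENNReal.ofReal s * ∫⁻ t in Ioi T, ENNReal.ofReal (t ^ (-(1 + s))) =
      ENNReal.ofReal (T ^ (-s)) := by
  have hlt : -(1 + s) < -1 := by linarith
  rw [← ofReal_integral_eq_lintegral_ofReal (integrableOn_Ioi_rpow_of_lt hlt hT)
    ((ae_restrict_iff' measurableSet_Ioi).2 (.of_forall fun t ht =>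
      Real.rpow_nonneg (hT.trans ht).le _)), integral_Ioi_rpow_of_lt hlt hT,
    ← ENNReal.ofReal_mul hs.le]
  congr 1
  rw [show -(1 + s) + 1 = -s by ring]
  field_simp

/-- Abelian theorem: the Mellin-type averages `s ∫₀^∞ t^{-(1+s)} F(t) dt` converge, as `s → 0⁺`,
to the limit of `F` at infinity. -/
lemma tendsto_mul_lintegral_rpow_neg {F : ℝ → ℝ≥0∞} {m : ℝ≥0∞} {s₀ : ℝ} (hs₀ : 0 < s₀)
    (hF : Tendsto F atTop (𝓝 m))
    (hfin : ∫⁻ t in Ioi (0 : ℝ), ENNReal.ofReal (t ^ (-(1 + s₀))) * F t ≠ ⊤) :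
    Tendsto (fun s : ℝ => ENNReal.ofReal s *
      ∫⁻ t in Ioi (0 : ℝ), ENNReal.ofReal (t ^ (-(1 + s))) * F t) (𝓝[>] 0) (𝓝 m) := by
  have hmeas : ∀ s : ℝ, Measurable fun t : ℝ => ENNReal.ofReal (t ^ (-(1 + s))) := fun s => by
    fun_prop
  have hT1 : ∀ {T : ℝ}, 0 < T → ∀ b : ℝ≥0∞,
      Tendsto (fun s : ℝ => ENNReal.ofReal (T ^ (-s)) * b) (𝓝[>] 0) (𝓝 b) := by
    intro T hT b
    have h : Tendsto (fun s : ℝ => T ^ (-s)) (𝓝[>] 0) (𝓝 1) := by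
      have hc : Continuous fun s : ℝ => T ^ (-s) :=
        continuous_const.rpow continuous_neg fun _ => Or.inl hT.ne'
      simpa using (hc.tendsto 0).mono_left nhdsWithin_le_nhds
    simpa using ENNReal.Tendsto.mul_const (b := b) (ENNReal.tendsto_ofReal h) (Or.inl (by simp))
  have hmul : ∀ {s T : ℝ}, 0 < s → 0 < T → ∀ b : ℝ≥0∞, ENNReal.ofReal s *
      ∫⁻ t in Ioi T, ENNReal.ofReal (t ^ (-(1 + s))) * b = ENNReal.ofReal (T ^ (-s)) * b := by
    intro s T hs hT b
    rw [lintegral_mul_const _ (hmeas s), ← mul_assoc, lintegral_Ioi_rpow_neg hs hT]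
  rw [tendsto_order]
  constructor
  · intro a ha
    obtain ⟨b, hab, hbm⟩ := exists_between ha
    obtain ⟨T, hT⟩ := eventually_atTop.1 (hF.eventually (lt_mem_nhds hbm))
    have hT0 : 0 < max T 1 := by positivity
    filter_upwards [(hT1 hT0 b).eventually (lt_mem_nhds hab), self_mem_nhdsWithin] with s hs hs0
    refine hs.trans_le ?_
    rw [← hmul hs0 hT0]
    refine mul_le_mul_right ?_ _
    calc ∫⁻ t in Ioi (max T 1), ENNReal.ofReal (t ^ (-(1 + s))) * b
        ≤ ∫⁻ t in Ioi (max T 1), ENNReal.ofReal (t ^ (-(1 + s))) * F t := by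
          refine setLIntegral_mono' measurableSet_Ioi fun t ht => ?_
          gcongr
          exact (hT t ((le_max_left _ _).trans (le_of_lt ht))).le
      _ ≤ _ := lintegral_mono_set (Ioi_subset_Ioi hT0.le)
  · intro a ha
    obtain ⟨b, hmb, hba⟩ := exists_between ha
    obtain ⟨T', hT'⟩ := eventually_atTop.1 (hF.eventually (gt_mem_nhds hmb))
    set T := max T' 1 with hTdef
    have hT0 : 0 < T := by positivity
    have hT1' : 1 ≤ T := le_max_right _ _
    set K := ENNReal.ofReal (T ^ s₀) *
      ∫⁻ t in Ioi (0 : ℝ), ENNReal.ofReal (t ^ (-(1 + s₀))) * F t with hK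
    have hKtop : K ≠ ⊤ := ENNReal.mul_ne_top ENNReal.ofReal_ne_top hfin
    have hlim : Tendsto (fun s : ℝ => ENNReal.ofReal s * K + ENNReal.ofReal (T ^ (-s)) * b)
        (𝓝[>] 0) (𝓝 b) := by
      have h0 : Tendsto (fun s : ℝ => ENNReal.ofReal s) (𝓝[>] 0) (𝓝 0) := by
        simpa using ENNReal.tendsto_ofReal
          ((tendsto_id (α := ℝ) (x := 𝓝 0)).mono_left (nhdsWithin_le_nhds (s := Ioi 0)))
      simpa using (ENNReal.Tendsto.mul_const h0 (Or.inr hKtop)).add (hT1 hT0 b)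
    filter_upwards [hlim.eventually (gt_mem_nhds hba), self_mem_nhdsWithin,
      nhdsWithin_le_nhds (gt_mem_nhds hs₀)] with s hs hs0 hss₀
    refine lt_of_le_of_lt ?_ hs
    rw [← hmul hs0 hT0, ← mul_add]
    gcongr
    rw [← Ioc_union_Ioi_eq_Ioi hT0.le]
    refine (lintegral_union_le _ _ _).trans ?_
    gcongr ?_ + ?_
    · rw [hK, ← lintegral_const_mul' _ _ ENNReal.ofReal_ne_top]
      refine (setLIntegral_mono' measurableSet_Ioc fun t ht => ?_).trans
        (lintegral_mono_set Ioc_subset_Ioi_self)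
      rw [← mul_assoc, ← ENNReal.ofReal_mul (by positivity)]
      gcongr
      have ht0 : 0 < t := ht.1
      calc t ^ (-(1 + s)) = t ^ (s₀ - s) * t ^ (-(1 + s₀)) := by
            rw [← Real.rpow_add ht0]; congr 1; ring
        _ ≤ T ^ s₀ * t ^ (-(1 + s₀)) := by
            gcongr
            calc t ^ (s₀ - s) ≤ T ^ (s₀ - s) :=
                  Real.rpow_le_rpow ht0.le ht.2 (by linarith)
              _ ≤ T ^ s₀ := Real.rpow_le_rpow_of_exponent_le hT1' (by linarith [mem_Ioi.1 hs0])
    · refine setLIntegral_mono' measurableSet_Ioi fun t ht => ?_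
      gcongr
      exact (hT' t ((le_max_left _ _).trans (le_of_lt ht))).le

lemma sPer_eq_lintegral_heatContent (n : ℕ) (s : ℝ) (E Ω : Set (EuclideanSpace ℝ (Fin n))) :
    sPer n s E Ω = 2 * ∫⁻ t in Ioi (0 : ℝ), ENNReal.ofReal (t ^ (-(1 + s))) *
      (heatContent n (E ∩ Ω) (Eᶜ ∩ Ω) t + heatContent n (E ∩ Ω) (Eᶜ ∩ Ωᶜ) t
        + heatContent n (E ∩ Ωᶜ) (Eᶜ ∩ Ω) t) := by
  have hm : ∀ A B, Measurable fun t : ℝ =>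
      ENNReal.ofReal (t ^ (-(1 + s))) * heatContent n A B t := fun A B =>
    Measurable.mul (by fun_prop) (measurable_heatContent A B)
  simp_rw [mul_add (ENNReal.ofReal _)]
  rw [lintegral_add_right _ (hm _ _), lintegral_add_left (hm _ _)]
  rfl

/-- balanced measure case: `Ω` open bounded with the collar bound
`𝓛ⁿ(D_r^Ω(Ωᶜ)) ≤ c* min{r^η, 1}` for some `c* > 0`, `η > 2s₀`, and
`Per_{s₀}(E,Ω) < ∞`. If `𝓛ⁿ(E∩Ω) = 𝓛ⁿ(Eᶜ∩Ω)`, then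
`lim_{s→0⁺} s Per_s(E,Ω) = 2 𝓛ⁿ(E∩Ω)`. -/
theorem statement15 (n : ℕ) (hn : 1 ≤ n) (Ω : Set (EuclideanSpace ℝ (Fin n)))
    (hΩo : IsOpen Ω) (hΩb : Bornology.IsBounded Ω)
    (E : Set (EuclideanSpace ℝ (Fin n))) (hE : MeasurableSet E)
    (s₀ : ℝ) (hs₀ : s₀ ∈ Set.Ioo (0:ℝ) (1/2)) (hfin : sPer n s₀ E Ω < ⊤)
    (c : ℝ) (hc : 0 < c) (η : ℝ) (hη : 2 * s₀ < η)
    (hbd : ∀ r ∈ Set.Icc (0:ℝ) 1,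
      volume (innerCollar n Ω r) ≤ ENNReal.ofReal (c * min (r ^ η) 1))
    (hbal : volume (E ∩ Ω) = volume (Eᶜ ∩ Ω)) :
    Tendsto (fun s : ℝ => ENNReal.ofReal s * sPer n s E Ω) (𝓝[>] (0:ℝ))
      (𝓝 (2 * volume (E ∩ Ω))) := by
  have hs (s : ℝ) := sPer_eq_lintegral_heatContent n s E Ω
  have hlim := tendsto_mul_lintegral_rpow_neg hs₀.1
    (tendsto_heatContent_perimeter hn hΩo.measurableSet hΩb hE hbal)
    (fun h => hfin.ne (by rw [hs, h]; simp))
  simp_rw [hs, mul_left_comm _ (2 : ℝ≥0∞)]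
  exact ENNReal.Tendsto.const_mul hlim (Or.inr (by simp))
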